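/- arXiv:1808.09584 — 5 statements merged into one kernel-verified Lean document; each statement's English description precedes it below -/
import Mathlib

section
/- Let X be a decomposable continuum that is irreducible between points p and q, and set C = X \ κ(q) and D = X \ κ(p). Then both C and D are nonempty and closed if and only if NB(F₁(X)) has exactly three elements; moreover, in that case NB(F₁(X)) = {C, D, C ∪ D}. -/
open Set Filter Metric

/-- `B` does not block `x`: the union of all subcontinua of `X` containing `x`
and contained in the complement of `B` is dense. -/
def NotBlocks {X : Type*} [TopologicalSpace X] (B : Set X) (x : X) : Prop :=
  Dense (⋃₀ {K : Set X | IsCompact K ∧ IsConnected K ∧ x ∈ K ∧ K ⊆ Bᶜ})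

/-- The hyperspace `NB(F₁(X))`: nonempty proper closed subsets that do not block
any point of their complement. -/
def NB (X : Type*) [TopologicalSpace X] : Set (Set X) :=
  {B | B.Nonempty ∧ B ≠ univ ∧ IsClosed B ∧ ∀ x ∉ B, NotBlocks B x}

/-- The hyperspace `NB*(F₁(X))`: nonempty proper closed subsets that do not block
at least one point of their complement. -/
def NBstar (X : Type*) [TopologicalSpace X] : Set (Set X) :=
  {B | B.Nonempty ∧ B ≠ univ ∧ IsClosed B ∧ ∃ x ∉ B, NotBlocks B x}

/-- `F₁(X)`: the one-point subsets of `X`. -/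
def F1 (X : Type*) [TopologicalSpace X] : Set (Set X) :=
  {A | ∃ x : X, A = {x}}

/-- `NWC(X)`: nonempty proper closed subsets with empty interior that are
non-weak cut sets. -/
def NWC (X : Type*) [TopologicalSpace X] : Set (Set X) :=
  {A | A.Nonempty ∧ A ≠ univ ∧ IsClosed A ∧ interior A = ∅ ∧
    ∀ x ∉ A, ∀ y ∉ A, ∃ K : Set X, IsCompact K ∧ IsConnected K ∧ K ⊆ Aᶜ ∧ x ∈ K ∧ y ∈ K}

/-- A shore set: a nonempty proper closed subset `A` such that some sequence of
subcontinua contained in the complement of `A` converges to `X` in the Hausdorff metric. -/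
def ShoreSet {X : Type*} [MetricSpace X] (A : Set X) : Prop :=
  A.Nonempty ∧ A ≠ univ ∧ IsClosed A ∧
    ∃ C : ℕ → Set X, (∀ n, IsCompact (C n) ∧ IsConnected (C n) ∧ C n ⊆ Aᶜ) ∧
      Tendsto (fun n => hausdorffDist (C n) (univ : Set X)) atTop (nhds 0)

/-- `S(X)`: the collection of all shore sets of `X`. -/
def Shore (X : Type*) [MetricSpace X] : Set (Set X) :=
  {A | ShoreSet A}

/-- The composant of a point `z`: the union of all proper subcontinua containing `z`. -/
def composant {X : Type*} [TopologicalSpace X] (z : X) : Set X :=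
  ⋃₀ {L : Set X | IsCompact L ∧ IsConnected L ∧ L ≠ univ ∧ z ∈ L}

/-- `X` is irreducible between `p` and `q`: no proper subcontinuum contains both. -/
def IrrBetween {X : Type*} [TopologicalSpace X] (p q : X) : Prop :=
  ∀ L : Set X, IsCompact L → IsConnected L → p ∈ L → q ∈ L → L = univ

/-- A subcontinuum `K` is decomposable if it is the union of two proper subcontinua. -/
def DecomposableSet {X : Type*} [TopologicalSpace X] (K : Set X) : Prop :=
  ∃ A B : Set X, IsCompact A ∧ IsConnected A ∧ A ⊆ K ∧ A ≠ K ∧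
    IsCompact B ∧ IsConnected B ∧ B ⊆ K ∧ B ≠ K ∧ A ∪ B = K

/-- `s(x)` relative to the point `p`: the union of all subcontinua containing `x`
and contained in `X \ {p}`. -/
def sComp {X : Type*} [TopologicalSpace X] (p x : X) : Set X :=
  ⋃₀ {K : Set X | IsCompact K ∧ IsConnected K ∧ x ∈ K ∧ K ⊆ ({p} : Set X)ᶜ}

theorem Set.ne_univ_of_notMem {α : Type*} {s : Set α} {a : α} (ha : a ∉ s) : s ≠ univ :=
  (ne_univ_iff_exists_notMem s).2 ⟨a, ha⟩

/-- Connected components in a closed set are closed. -/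
theorem IsClosed.isClosed_connectedComponentIn {X : Type*} [TopologicalSpace X] {F : Set X}
    (hF : IsClosed F) (x : X) : IsClosed (connectedComponentIn F x) := by
  by_cases hx : x ∈ F
  · refine isClosed_of_closure_subset ?_
    exact isPreconnected_connectedComponentIn.closure.subset_connectedComponentIn
      (subset_closure (mem_connectedComponentIn hx))
      (closure_minimal (connectedComponentIn_subset F x) hF)
  · rw [connectedComponentIn_eq_empty hx]
    exact isClosed_empty

/-- Nonempty compact connected subsets. -/
def IsSubcontinuum {X : Type*} [TopologicalSpace X] (K : Set X) : Prop :=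
  IsCompact K ∧ IsConnected K

theorem isSubcontinuum_univ {X : Type*} [TopologicalSpace X] [CompactSpace X] [ConnectedSpace X] :
    IsSubcontinuum (univ : Set X) :=
  ⟨isCompact_univ, isConnected_univ⟩

namespace IsSubcontinuum

variable {X : Type*} [TopologicalSpace X] {K L : Set X}

theorem singleton (x : X) : IsSubcontinuum {x} := ⟨isCompact_singleton, isConnected_singleton⟩

theorem union (hK : IsSubcontinuum K) (hL : IsSubcontinuum L) {x : X} (hxK : x ∈ K)
    (hxL : x ∈ L) : IsSubcontinuum (K ∪ L) :=
  ⟨hK.1.union hL.1, hK.2.union ⟨x, hxK, hxL⟩ hL.2⟩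

theorem isClosed [T2Space X] (hK : IsSubcontinuum K) : IsClosed K := hK.1.isClosed

/-- The closure of a union of subcontinua with a common point is a subcontinuum. -/
theorem closure_sUnion [CompactSpace X] {S : Set (Set X)} {x : X} (hS : S.Nonempty)
    (hc : ∀ N ∈ S, IsSubcontinuum N) (hx : ∀ N ∈ S, x ∈ N) :
    IsSubcontinuum (closure (⋃₀ S)) := by
  refine ⟨isClosed_closure.isCompact, IsConnected.closure ⟨?_, ?_⟩⟩
  · obtain ⟨N, hN⟩ := hS
    exact ⟨x, N, hN, hx N hN⟩
  · exact isPreconnected_sUnion x S hx fun N hN => (hc N hN).2.isPreconnected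

/-- Boundary bumping. -/
theorem exists_meets_closure_diff [T2Space X] (hK : IsSubcontinuum K) {F : Set X}
    (hF : IsClosed F) {x : X} (hxK : x ∈ K) (hxF : x ∈ F) (hKF : ¬ K ⊆ F) :
    ∃ N, IsSubcontinuum N ∧ x ∈ N ∧ N ⊆ K ∩ F ∧ (N ∩ closure (K \ F)).Nonempty := by
  have hYc : IsCompact (K ∩ F) := hK.1.inter_right hF
  have : CompactSpace ↥(K ∩ F) := isCompact_iff_compactSpace.mp hYc
  let y : ↥(K ∩ F) := ⟨x, hxK, hxF⟩
  refine ⟨Subtype.val '' connectedComponent y,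
    ⟨isClosed_connectedComponent.isCompact.image continuous_subtype_val,
      isConnected_connectedComponent.image _ continuous_subtype_val.continuousOn⟩,
    ⟨y, mem_connectedComponent, rfl⟩, Subtype.coe_image_subset _ _, ?_⟩
  by_contra hne
  rw [not_nonempty_iff_eq_empty] at hne
  have hU : IsOpen ((Subtype.val : ↥(K ∩ F) → X) ⁻¹' (closure (K \ F))ᶜ) :=
    isClosed_closure.isOpen_compl.preimage continuous_subtype_val
  have hsub : connectedComponent y ⊆ Subtype.val ⁻¹' (closure (K \ F))ᶜ := fun z hz hz' =>
    (hne ▸ (⟨⟨z, hz, rfl⟩, hz'⟩ :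
      (z : X) ∈ Subtype.val '' connectedComponent y ∩ closure (K \ F)) : (z : X) ∈ (∅ : Set X))
  obtain ⟨Z, hZ, hyZ, hZU⟩ : ∃ Z : Set ↥(K ∩ F), IsClopen Z ∧ y ∈ Z ∧
      Z ⊆ Subtype.val ⁻¹' (closure (K \ F))ᶜ := by
    rw [connectedComponent_eq_iInter_isClopen] at hsub
    have : Nonempty { s : Set ↥(K ∩ F) // IsClopen s ∧ y ∈ s } :=
      ⟨⟨Set.univ, isClopen_univ, mem_univ _⟩⟩
    obtain ⟨s, hs⟩ := exists_subset_nhds_of_compactSpace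
      (V := fun s : { s : Set ↥(K ∩ F) // IsClopen s ∧ y ∈ s } => s.1)
      (fun s t => ⟨⟨s.1 ∩ t.1, s.2.1.inter t.2.1, s.2.2, t.2.2⟩, inter_subset_left,
        inter_subset_right⟩) (fun s => s.2.1.isClosed)
      (fun z hz => hU.mem_nhds (hsub hz))
    exact ⟨s.1, s.2.1, s.2.2, hs⟩
  have hc1 : IsClosed (Subtype.val '' Z) :=
    (hZ.isClosed.isCompact.image continuous_subtype_val).isClosed
  have hc2 : IsClosed (Subtype.val '' Zᶜ ∪ closure (K \ F)) :=
    (hZ.compl.isClosed.isCompact.image continuous_subtype_val).isClosed.union isClosed_closure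
  have hcov : K ⊆ Subtype.val '' Z ∪ (Subtype.val '' Zᶜ ∪ closure (K \ F)) := by
    intro z hz
    by_cases hzF : z ∈ F
    · by_cases hzZ : (⟨z, hz, hzF⟩ : ↥(K ∩ F)) ∈ Z
      · exact Or.inl ⟨_, hzZ, rfl⟩
      · exact Or.inr (Or.inl ⟨_, hzZ, rfl⟩)
    · exact Or.inr (Or.inr (subset_closure ⟨hz, hzF⟩))
  have hdisj : Disjoint (Subtype.val '' Z) (Subtype.val '' Zᶜ ∪ closure (K \ F)) := by
    rw [Set.disjoint_left]
    rintro _ ⟨z, hz, rfl⟩ (⟨w, hw, hwz⟩ | hz')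
    · exact hw (Subtype.val_injective hwz ▸ hz)
    · exact hZU hz hz'
  rcases (isPreconnected_iff_subset_of_fully_disjoint_closed hK.isClosed).1
    hK.2.isPreconnected _ _ hc1 hc2 hcov hdisj with h | h
  · exact hKF (h.trans ((Subtype.coe_image_subset _ _).trans inter_subset_right))
  · exact Set.disjoint_left.1 hdisj ⟨y, hyZ, rfl⟩ (h hxK)

/-- The subcontinua of `K` through `x` avoiding the closed set `E` accumulate at `E`. -/
theorem closure_sUnion_avoiding_meets [T2Space X] [CompactSpace X] (hK : IsSubcontinuum K)
    {E : Set X} (hE : IsClosed E) {x : X} (hxK : x ∈ K) (hxE : x ∉ E) (hKE : (K ∩ E).Nonempty) :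
    (closure (⋃₀ {N | IsSubcontinuum N ∧ x ∈ N ∧ N ⊆ K \ E}) ∩ E).Nonempty := by
  set T := closure (⋃₀ {N | IsSubcontinuum N ∧ x ∈ N ∧ N ⊆ K \ E}) with hT
  by_contra hne
  have hET : E ⊆ Tᶜ := fun z hz hzT => hne ⟨z, hzT, hz⟩
  obtain ⟨V, hV, hEV, hVT⟩ := normal_exists_closure_subset hE isClosed_closure.isOpen_compl hET
  have hmem : ∀ N, IsSubcontinuum N → x ∈ N → N ⊆ K \ E → N ⊆ T := fun N h1 h2 h3 z hz =>
    subset_closure ⟨N, ⟨h1, h2, h3⟩, hz⟩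
  have hxT : x ∈ T := hmem {x} (singleton x) rfl (singleton_subset_iff.2 ⟨hxK, hxE⟩) rfl
  obtain ⟨k, hkK, hkE⟩ := hKE
  obtain ⟨N, hN, hxN, hNsub, z, hzN, hz⟩ := hK.exists_meets_closure_diff hV.isClosed_compl hxK
    (fun hxV => hVT (subset_closure hxV) hxT) (fun h => h hkK (hEV hkE))
  refine hVT (closure_mono ?_ hz)
    (hmem N hN hxN (fun w hw => ⟨(hNsub hw).1, fun hwE => (hNsub hw).2 (hEV hwE)⟩) hzN)
  rintro w ⟨-, hw⟩
  simpa using hw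

end IsSubcontinuum

section Composant

variable {X : Type*} [TopologicalSpace X]

theorem mem_composant {z w : X} :
    w ∈ composant z ↔ ∃ L, IsSubcontinuum L ∧ L ≠ univ ∧ z ∈ L ∧ w ∈ L :=
  ⟨fun ⟨L, ⟨h1, h2, h3, h4⟩, h5⟩ => ⟨L, ⟨h1, h2⟩, h3, h4, h5⟩,
    fun ⟨L, ⟨h1, h2⟩, h3, h4, h5⟩ => ⟨L, ⟨h1, h2, h3, h4⟩, h5⟩⟩

theorem IsSubcontinuum.subset_composant {L : Set X} (hL : IsSubcontinuum L) (hne : L ≠ univ)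
    {z : X} (hz : z ∈ L) : L ⊆ composant z := fun _ hw =>
  mem_composant.2 ⟨L, hL, hne, hz, hw⟩

theorem IsSubcontinuum.eq_univ_of_notMem_composant {L : Set X} (hL : IsSubcontinuum L) {z w : X}
    (hz : z ∈ L) (hw : w ∈ L) (h : w ∉ composant z) : L = univ := by
  by_contra hne
  exact h (hL.subset_composant hne hz hw)

theorem IrrBetween.eq_univ {p q : X} (h : IrrBetween p q) {L : Set X} (hL : IsSubcontinuum L)
    (hp : p ∈ L) (hq : q ∈ L) : L = univ := h L hL.1 hL.2 hp hq

theorem IrrBetween.symm {p q : X} (h : IrrBetween p q) : IrrBetween q p :=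
  fun L h1 h2 h3 h4 => h L h1 h2 h4 h3

theorem IrrBetween.notMem_composant {p q : X} (h : IrrBetween p q) : q ∉ composant p := by
  intro hq
  obtain ⟨L, hL, hne, hpL, hqL⟩ := mem_composant.1 hq
  exact hne (h.eq_univ hL hpL hqL)

/-- In a space irreducible between `p` and `q`, the closure of the complement of a subcontinuum
containing `p` but not `q` is a subcontinuum. -/
theorem IrrBetween.isSubcontinuum_closure_compl [T2Space X] [CompactSpace X] [ConnectedSpace X]
    {p q : X} (h : IrrBetween p q) {L : Set X} (hL : IsSubcontinuum L) (hp : p ∈ L)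
    (hq : q ∉ L) : IsSubcontinuum (closure Lᶜ) := by
  have key : ∀ F G : Set X, IsClosed F → IsClosed G → closure Lᶜ ⊆ F ∪ G → Disjoint F G →
      q ∈ F → closure Lᶜ ⊆ F := by
    intro F G hF hG hcov hdisj hqF
    have hLFG : L ∪ (F ∪ G) = univ := eq_univ_of_forall fun z =>
      or_iff_not_imp_left.2 fun hz => hcov (subset_closure hz)
    have hconn : IsSubcontinuum (L ∪ F) := by
      have hcl : IsClosed (L ∪ F) := hL.isClosed.union hF
      refine ⟨hcl.isCompact, ⟨p, Or.inl hp⟩, ?_⟩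
      rw [isPreconnected_iff_subset_of_fully_disjoint_closed hcl]
      have aux : ∀ S T : Set X, IsClosed S → IsClosed T → L ∪ F ⊆ S ∪ T → Disjoint S T →
          L ⊆ S → L ∪ F ⊆ S := by
        intro S T hS hT hST hdST hLS
        have hHc : IsClosed (T ∩ F) := hT.inter hF
        have hd : Disjoint (S ∪ G) (T ∩ F) := by
          rw [Set.disjoint_left]
          rintro z (hz | hz) ⟨hzT, hzF⟩
          · exact Set.disjoint_left.1 hdST hz hzT
          · exact Set.disjoint_left.1 hdisj hzF hz
        have hcov' : (univ : Set X) ⊆ (S ∪ G) ∪ (T ∩ F) := by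
          intro z _
          have hz : z ∈ L ∪ (F ∪ G) := hLFG ▸ mem_univ z
          rcases hz with hz | hz | hz
          · exact Or.inl (Or.inl (hLS hz))
          · rcases hST (Or.inr hz) with hz' | hz'
            · exact Or.inl (Or.inl hz')
            · exact Or.inr ⟨hz', hz⟩
          · exact Or.inl (Or.inr hz)
        rcases (isPreconnected_iff_subset_of_fully_disjoint_closed isClosed_univ).1
          isPreconnected_univ _ _ (hS.union hG) hHc hcov' hd with h' | h'
        · intro z hz
          rcases hST hz with hzS | hzT
          · exact hzS
          · rcases hz with hz | hz
            · exact hLS hz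
            · exact (Set.disjoint_left.1 hd (h' (mem_univ z)) ⟨hzT, hz⟩).elim
        · exact (Set.disjoint_left.1 hd (Or.inl (hLS hp)) (h' (mem_univ p))).elim
      intro S T hS hT hST hdST
      rcases (isPreconnected_iff_subset_of_fully_disjoint_closed hL.isClosed).1
        hL.2.isPreconnected _ _ hS hT (subset_union_left.trans hST) hdST with h' | h'
      · exact Or.inl (aux S T hS hT hST hdST h')
      · exact Or.inr (aux T S hT hS (union_comm S T ▸ hST) hdST.symm h')
    have huniv := h.eq_univ hconn (Or.inl hp) (Or.inr hqF)
    refine closure_minimal (fun z hz => ?_) hF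
    have : z ∈ L ∪ F := huniv ▸ mem_univ z
    exact this.resolve_left hz
  refine ⟨isClosed_closure.isCompact, ⟨q, subset_closure hq⟩, ?_⟩
  rw [isPreconnected_iff_subset_of_fully_disjoint_closed isClosed_closure]
  intro F G hF hG hcov hdisj
  rcases hcov (subset_closure hq) with hqF | hqG
  · exact Or.inl (key F G hF hG hcov hdisj hqF)
  · exact Or.inr (key G F hG hF (union_comm F G ▸ hcov) hdisj.symm hqG)

/-- In a second countable compact space, a nonempty open subset of a composant meets the interior
of a proper subcontinuum through the base point. -/
theorem exists_interior_meets_of_subset_composant [T2Space X] [CompactSpace X]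
    [SecondCountableTopology X] {p : X} {V : Set X} (hV : IsOpen V) (hVne : V.Nonempty)
    (hVp : V ⊆ composant p) :
    ∃ L, IsSubcontinuum L ∧ L ≠ univ ∧ p ∈ L ∧ (interior L ∩ V).Nonempty := by
  obtain ⟨b, hbc, hbe, hb⟩ := TopologicalSpace.exists_countable_basis X
  have : Countable ↥b := hbc
  let Q : ↥b → Set X := fun U => connectedComponentIn (U.1)ᶜ p
  have hQcl : ∀ U, IsClosed (Q U) := fun U =>
    (hb.isOpen U.2).isClosed_compl.isClosed_connectedComponentIn p
  let f : Option ↥b → Set X := fun o => o.elim Vᶜ Q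
  have hf : ∀ o, IsClosed (f o) := by
    rintro (_ | U)
    · exact hV.isClosed_compl
    · exact hQcl U
  have hcov : ⋃ o, f o = univ := by
    refine eq_univ_of_forall fun z => mem_iUnion.2 ?_
    by_cases hz : z ∈ V
    · obtain ⟨L, hL, hne, hpL, hzL⟩ := mem_composant.1 (hVp hz)
      obtain ⟨y, hy⟩ := (ne_univ_iff_exists_notMem L).1 hne
      obtain ⟨U, hU, hyU, hUL⟩ := hb.exists_subset_of_mem_open (u := Lᶜ) hy
        hL.isClosed.isOpen_compl
      exact ⟨some ⟨U, hU⟩, hL.2.isPreconnected.subset_connectedComponentIn hpL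
        (subset_compl_comm.1 hUL) hzL⟩
    · exact ⟨none, hz⟩
  obtain ⟨z, hzV, hz⟩ := (dense_iUnion_interior_of_closed hf hcov).inter_open_nonempty V hV hVne
  obtain ⟨o, ho⟩ := mem_iUnion.1 hz
  rcases o with _ | U
  · exact (interior_subset ho hzV).elim
  · have hzQ : z ∈ Q U := interior_subset ho
    have hpU : p ∈ (U.1)ᶜ := by
      by_contra hp
      have : Q U = ∅ := connectedComponentIn_eq_empty hp
      exact (this ▸ hzQ : z ∈ (∅ : Set X))
    have hUne : (U.1).Nonempty := by
      rw [nonempty_iff_ne_empty]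
      intro h
      exact hbe (h ▸ U.2)
    obtain ⟨u, hu⟩ := hUne
    exact ⟨Q U, ⟨(hQcl U).isCompact, isConnected_connectedComponentIn_iff.2 hpU⟩,
      fun h => connectedComponentIn_subset (U.1)ᶜ p (h ▸ mem_univ u : u ∈ Q U) hu,
      mem_connectedComponentIn hpU, z, ho, hzV⟩

end Composant

section NonBlockers

variable {X : Type*} [TopologicalSpace X] {E : Set X}

theorem exists_isSubcontinuum_of_mem_NB (hE : E ∈ NB X) {x : X} (hx : x ∉ E) {V : Set X}
    (hV : IsOpen V) (hVne : V.Nonempty) :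
    ∃ N, IsSubcontinuum N ∧ x ∈ N ∧ Disjoint N E ∧ (N ∩ V).Nonempty := by
  obtain ⟨z, hzV, N, ⟨h1, h2, h3, h4⟩, hzN⟩ := (hE.2.2.2 x hx).inter_open_nonempty V hV hVne
  exact ⟨N, ⟨h1, h2⟩, h3, disjoint_left.2 h4, z, hzN, hzV⟩

theorem interior_eq_empty_of_mem_NB (hE : E ∈ NB X) : interior E = ∅ := by
  by_contra hne
  obtain ⟨x, hx⟩ := (ne_univ_iff_exists_notMem E).1 hE.2.1
  obtain ⟨N, -, -, hNE, z, hzN, hz⟩ := exists_isSubcontinuum_of_mem_NB hE hx isOpen_interior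
    (nonempty_iff_ne_empty.2 hne)
  exact disjoint_left.1 hNE hzN (interior_subset hz)

end NonBlockers

/-- A space irreducible between `p` and `q` covered by two proper subcontinua, the first
containing `p` and the second containing `q`. -/
structure IrrCover {X : Type*} [TopologicalSpace X] (p q : X) (A B : Set X) : Prop where
  irr : IrrBetween p q
  left : IsSubcontinuum A
  right : IsSubcontinuum B
  union_eq : A ∪ B = univ
  mem_left : p ∈ A
  mem_right : q ∈ B
  left_ne : A ≠ univ
  right_ne : B ≠ univ

theorem DecomposableSet.exists_irrCover {X : Type*} [TopologicalSpace X] {p q : X}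
    (hdec : DecomposableSet (univ : Set X)) (hirr : IrrBetween p q) :
    ∃ A B, IrrCover p q A B := by
  obtain ⟨A, B, hAc, hA, -, hAne, hBc, hB, -, hBne, hAB⟩ := hdec
  have hp : p ∈ A ∪ B := hAB ▸ mem_univ p
  have hq : q ∈ A ∪ B := hAB ▸ mem_univ q
  rcases hp with hp | hp
  · have hqB := hq.resolve_left fun hq => hAne (hirr A hAc hA hp hq)
    exact ⟨A, B, hirr, ⟨hAc, hA⟩, ⟨hBc, hB⟩, hAB, hp, hqB, hAne, hBne⟩
  · have hqA := hq.resolve_right fun hq => hBne (hirr B hBc hB hp hq)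
    exact ⟨B, A, hirr, ⟨hBc, hB⟩, ⟨hAc, hA⟩, union_comm A B ▸ hAB, hp, hqA, hBne, hAne⟩

namespace IrrCover

section Topological

variable {X : Type*} [TopologicalSpace X] {p q : X} {A B : Set X}

theorem symm (h : IrrCover p q A B) : IrrCover q p B A :=
  ⟨h.irr.symm, h.right, h.left, union_comm A B ▸ h.union_eq, h.mem_right, h.mem_left, h.right_ne,
    h.left_ne⟩

theorem mem_or_mem (h : IrrCover p q A B) (x : X) : x ∈ A ∨ x ∈ B := by
  have : x ∈ A ∪ B := h.union_eq ▸ mem_univ x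
  exact this

theorem notMem_left (h : IrrCover p q A B) : q ∉ A := fun hq =>
  h.left_ne (h.irr.eq_univ h.left h.mem_left hq)

theorem notMem_right (h : IrrCover p q A B) : p ∉ B := h.symm.notMem_left

theorem left_subset (h : IrrCover p q A B) : A ⊆ composant p :=
  h.left.subset_composant h.left_ne h.mem_left

theorem right_subset (h : IrrCover p q A B) : B ⊆ composant q := h.symm.left_subset

theorem mem_left_of_notMem_composant (h : IrrCover p q A B) {c : X} (hc : c ∉ composant q) :
    c ∈ A := (h.mem_or_mem c).resolve_right fun hB => hc (h.right_subset hB)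

theorem mem_composant_of_notMem (h : IrrCover p q A B) {c : X} (hc : c ∉ composant q) :
    c ∈ composant p := h.left_subset (h.mem_left_of_notMem_composant hc)

theorem notMem_of_ne_univ (h : IrrCover p q A B) {L : Set X} (hL : IsSubcontinuum L)
    (hp : p ∈ L) (hne : L ≠ univ) : q ∉ L := fun hq => hne (h.irr.eq_univ hL hp hq)

/-- A proper subcontinuum through `p` can be enlarged to one containing the left piece. -/
theorem union_left (h : IrrCover p q A B) {L : Set X} (hL : IsSubcontinuum L) (hp : p ∈ L)
    (hne : L ≠ univ) : IsSubcontinuum (L ∪ A) ∧ q ∉ L ∪ A :=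
  ⟨hL.union h.left hp h.mem_left,
    fun hq => hq.elim (h.notMem_of_ne_univ hL hp hne) h.notMem_left⟩

/-- Any point outside the composant of `q` can play the role of `p`. -/
theorem of_notMem_composant (h : IrrCover p q A B) {c : X} (hc : c ∉ composant q) :
    IrrCover c q A B where
  irr _ h1 h2 h3 h4 := IsSubcontinuum.eq_univ_of_notMem_composant ⟨h1, h2⟩ h4 h3 hc
  left := h.left
  right := h.right
  union_eq := h.union_eq
  mem_left := h.mem_left_of_notMem_composant hc
  mem_right := h.mem_right
  left_ne := h.left_ne
  right_ne := h.right_ne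

theorem eq_univ_of_notMem_of_notMem (h : IrrCover p q A B) {c d : X} (hc : c ∉ composant q)
    (hd : d ∉ composant p) {L : Set X} (hL : IsSubcontinuum L) (hcL : c ∈ L) (hdL : d ∈ L) :
    L = univ := by
  have hLB : L ∪ B = univ := (h.of_notMem_composant hc).irr.eq_univ
    (hL.union h.right hdL (h.symm.mem_left_of_notMem_composant hd)) (Or.inl hcL)
    (Or.inr h.mem_right)
  have hpL : p ∈ L ∪ B := hLB ▸ mem_univ p
  exact hL.eq_univ_of_notMem_composant (hpL.resolve_right h.notMem_right) hdL hd

end Topological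

section Compact

variable {X : Type*} [TopologicalSpace X] [T2Space X] {p q : X} {A B : Set X}

theorem compl_right_subset_interior (h : IrrCover p q A B) : Bᶜ ⊆ interior A :=
  interior_maximal (fun z hz => (h.mem_or_mem z).resolve_right hz) h.right.isClosed.isOpen_compl

theorem mem_interior_left (h : IrrCover p q A B) {c : X} (hc : c ∉ composant q) :
    c ∈ interior A := h.compl_right_subset_interior fun hB => hc (h.right_subset hB)

/-- A nonblocker meets the closure of `Aᶜ` only if it contains the complement of the composant
of `p`. -/
theorem disjoint_closure_compl_left (h : IrrCover p q A B) {E : Set X} (hE : E ∈ NB X) {d : X}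
    (hd : d ∉ composant p) (hdE : d ∉ E) : Disjoint E (closure Aᶜ) := by
  obtain ⟨N, hN, hdN, hNE, z, hzN, hz⟩ := exists_isSubcontinuum_of_mem_NB hE hdE isOpen_interior
    ⟨p, h.mem_interior_left h.irr.symm.notMem_composant⟩
  have hNA : N ∪ A = univ := (hN.union h.left hzN (interior_subset hz)).eq_univ_of_notMem_composant
    (Or.inr h.mem_left) (Or.inl hdN) hd
  refine hNE.symm.mono_right (closure_minimal (fun w hw => ?_) hN.isClosed)
  have : w ∈ N ∪ A := hNA ▸ mem_univ w
  exact this.resolve_right hw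

/-- From a point outside both complements of composants one reaches the left piece while
avoiding these complements. -/
theorem exists_meets_left (h : IrrCover p q A B) {x : X} (hxp : x ∈ composant p)
    (hxq : x ∈ composant q) :
    ∃ N, IsSubcontinuum N ∧ x ∈ N ∧ N ⊆ composant p ∩ composant q ∧ (N ∩ A).Nonempty := by
  by_cases hxA : x ∈ A
  · exact ⟨{x}, .singleton x, rfl, singleton_subset_iff.2 ⟨hxp, hxq⟩, x, rfl, hxA⟩
  · obtain ⟨L, hL, hLne, hpL, hxL⟩ := mem_composant.1 hxp
    obtain ⟨N, hN, hxN, hNs, z, hzN, hz⟩ := hL.exists_meets_closure_diff h.right.isClosed hxL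
      ((h.mem_or_mem x).resolve_left hxA) (fun hLB => h.notMem_right (hLB hpL))
    refine ⟨N, hN, hxN, fun w hw => ⟨hL.subset_composant hLne hpL (hNs hw).1,
      h.right_subset (hNs hw).2⟩, z, hzN, ?_⟩
    exact closure_minimal (fun w hw => (h.mem_or_mem w).resolve_right hw.2) h.left.isClosed hz

variable [CompactSpace X]

theorem closure_sUnion_meets (h : IrrCover p q A B) (hC : IsClosed (composant q)ᶜ) {x : X}
    (hxp : x ∈ composant p) (hxq : x ∈ composant q) :
    (closure (⋃₀ {N | IsSubcontinuum N ∧ x ∈ N ∧ N ⊆ composant p ∩ composant q}) ∩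
      (composant q)ᶜ).Nonempty := by
  obtain ⟨N, hN, hxN, hNs, y, hyN, hyA⟩ := h.exists_meets_left hxp hxq
  obtain ⟨z, hz, hzC⟩ := h.left.closure_sUnion_avoiding_meets hC hyA (not_not.2 (hNs hyN).2)
    ⟨p, h.mem_left, h.irr.symm.notMem_composant⟩
  refine ⟨z, closure_mono ?_ hz, hzC⟩
  rintro w ⟨K, ⟨hK, hyK, hKs⟩, hwK⟩
  exact ⟨N ∪ K, ⟨hN.union hK hyN hyK, Or.inl hxN, union_subset hNs fun v hv =>
    ⟨h.left_subset (hKs hv).1, not_not.1 (hKs hv).2⟩⟩, Or.inr hwK⟩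

variable [ConnectedSpace X]

theorem dense_composant (h : IrrCover p q A B) : Dense (composant p) := by
  intro y
  by_cases hy : y = p
  · exact subset_closure (hy ▸ h.left_subset h.mem_left)
  · obtain ⟨z, hz, rfl⟩ := isSubcontinuum_univ.closure_sUnion_avoiding_meets
      (isClosed_singleton (x := y)) (mem_univ p) (fun hp => hy hp.symm) ⟨y, mem_univ y, rfl⟩
    refine closure_mono ?_ hz
    rintro w ⟨N, ⟨hN, hpN, hNy⟩, hwN⟩
    exact hN.subset_composant (ne_univ_of_notMem fun hz => (hNy hz).2 rfl) hpN hwN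

theorem interior_compl_composant (h : IrrCover p q A B) : interior (composant p)ᶜ = ∅ :=
  h.dense_composant.interior_compl

/-- A nonblocker missing `p` misses the interior of every proper subcontinuum through `p`. -/
theorem disjoint_interior (h : IrrCover p q A B) {E : Set X} (hE : E ∈ NB X) (hpE : p ∉ E)
    {L : Set X} (hL : IsSubcontinuum L) (hp : p ∈ L) (hq : q ∉ L) : Disjoint E (interior L) := by
  obtain ⟨N, hN, hpN, hNE, z, hzN, hz⟩ := exists_isSubcontinuum_of_mem_NB hE hpE
    hL.isClosed.isOpen_compl ⟨q, hq⟩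
  have hM := h.irr.isSubcontinuum_closure_compl hL hp hq
  have hNM := h.irr.eq_univ (hN.union hM hzN (subset_closure hz)) (Or.inl hpN)
    (Or.inr (subset_closure hq))
  refine disjoint_left.2 fun e heE heL => ?_
  have he : e ∈ N ∪ closure Lᶜ := hNM ▸ mem_univ e
  rcases he with he | he
  · exact disjoint_left.1 hNE he heE
  · rw [closure_compl] at he
    exact he heL

theorem subset_or_subset (h : IrrCover p q A B) {E : Set X} (hE : E ∈ NB X) :
    (composant q)ᶜ ⊆ E ∨ (composant p)ᶜ ⊆ E := by
  by_contra hcon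
  rw [not_or, not_subset, not_subset] at hcon
  obtain ⟨⟨c, hc, hcE⟩, d, hd, hdE⟩ := hcon
  obtain ⟨e, he⟩ := hE.1
  have h' := h.of_notMem_composant hc
  have h1 := disjoint_left.1 (h'.disjoint_interior hE hcE h.left h'.mem_left h.notMem_left) he
  have h2 := disjoint_left.1 (h.disjoint_closure_compl_left hE hd hdE) he
  rw [closure_compl] at h2
  exact h2 h1

/-- If the complement of the composant of `p` is nowhere dense, every point of the composant
is interior to a proper subcontinuum through `p` containing the left piece. -/
theorem exists_mem_interior [SecondCountableTopology X] (h : IrrCover p q A B)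
    (hD : interior (closure (composant p)ᶜ) = ∅) {e : X} (he : e ∈ composant p) :
    ∃ P, IsSubcontinuum P ∧ A ⊆ P ∧ q ∉ P ∧ e ∈ interior P := by
  obtain ⟨L, hL, hLne, hpL, heL⟩ := mem_composant.1 he
  obtain ⟨hL0, hqL0⟩ := h.union_left hL hpL hLne
  set L0 := L ∪ A
  have hV : IsOpen (L0ᶜ ∩ (closure (composant p)ᶜ)ᶜ) :=
    hL0.isClosed.isOpen_compl.inter isClosed_closure.isOpen_compl
  have hVne : (L0ᶜ ∩ (closure (composant p)ᶜ)ᶜ).Nonempty :=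
    (interior_eq_empty_iff_dense_compl.1 hD).inter_open_nonempty _ hL0.isClosed.isOpen_compl
      ⟨q, hqL0⟩
  obtain ⟨K, hK, hKne, hpK, y, hyK, hyL0, -⟩ := exists_interior_meets_of_subset_composant hV hVne
    fun z hz => not_not.1 fun hz' => hz.2 (subset_closure hz')
  have hP : IsSubcontinuum (K ∪ L0) := hK.union hL0 hpK (Or.inl hpL)
  have hqP : q ∉ K ∪ L0 := fun hq => hq.elim (h.notMem_of_ne_univ hK hpK hKne) hqL0
  refine ⟨K ∪ L0, hP, fun z hz => Or.inr (Or.inr hz), hqP, ?_⟩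
  have hM := h.irr.isSubcontinuum_closure_compl hP (Or.inl hpK) hqP
  by_contra heP
  have heM : e ∈ closure (K ∪ L0)ᶜ := by rwa [closure_compl]
  have huniv := h.irr.eq_univ (hM.union hL0 heM (Or.inl heL)) (Or.inr (Or.inl hpL))
    (Or.inl (subset_closure hqP))
  have hy : y ∈ closure (K ∪ L0)ᶜ ∪ L0 := huniv ▸ mem_univ y
  rcases hy with hy | hy
  · rw [closure_compl] at hy
    exact hy (interior_mono subset_union_left hyK)
  · exact hyL0 hy

theorem isClosed_compl_composant [SecondCountableTopology X] (h : IrrCover p q A B)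
    (hD : interior (closure (composant p)ᶜ) = ∅) : IsClosed (composant p)ᶜ := by
  rw [isClosed_compl_iff, isOpen_iff_forall_mem_open]
  intro e he
  obtain ⟨P, hP, hAP, hqP, heP⟩ := h.exists_mem_interior hD he
  exact ⟨interior P, interior_subset.trans
    (hP.subset_composant (ne_univ_of_notMem hqP) (hAP h.mem_left)), isOpen_interior, heP⟩

theorem subset_of_not_subset [SecondCountableTopology X] (h : IrrCover p q A B)
    (hD : interior (closure (composant p)ᶜ) = ∅) {E : Set X} (hE : E ∈ NB X)
    (hCE : ¬ (composant q)ᶜ ⊆ E) : E ⊆ (composant p)ᶜ := by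
  intro e heE hep
  obtain ⟨c, hc, hcE⟩ := not_subset.1 hCE
  have h' := h.of_notMem_composant hc
  obtain ⟨P, hP, hAP, hqP, heP⟩ := h.exists_mem_interior hD hep
  exact disjoint_left.1 (h'.disjoint_interior hE hcE hP (hAP h'.mem_left) hqP) heE heP

theorem subset_union [SecondCountableTopology X] (h : IrrCover p q A B)
    (hC : interior (closure (composant q)ᶜ) = ∅) (hD : interior (closure (composant p)ᶜ) = ∅)
    {E : Set X} (hE : E ∈ NB X) : E ⊆ (composant q)ᶜ ∪ (composant p)ᶜ := by
  intro e heE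
  by_contra he
  simp only [mem_union, mem_compl_iff, not_or, not_not] at he
  obtain ⟨P, hP, hAP, hqP, heP⟩ := h.exists_mem_interior hD he.2
  obtain ⟨R, hR, hBR, hpR, heR⟩ := h.symm.exists_mem_interior hC he.1
  obtain ⟨x, hx⟩ := (ne_univ_iff_exists_notMem E).1 hE.2.1
  obtain ⟨N, hN, hxN, hNE, y, hyN, hy⟩ := exists_isSubcontinuum_of_mem_NB hE hx
    hP.isClosed.isOpen_compl ⟨q, hqP⟩
  obtain ⟨K, hK, hxK, hKE, z, hzK, hz⟩ := exists_isSubcontinuum_of_mem_NB hE hx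
    hR.isClosed.isOpen_compl ⟨p, hpR⟩
  have h1 := hN.union (h.irr.isSubcontinuum_closure_compl hP (hAP h.mem_left) hqP) hyN
    (subset_closure hy)
  have h2 := hK.union (h.irr.symm.isSubcontinuum_closure_compl hR (hBR h.mem_right) hpR) hzK
    (subset_closure hz)
  have huniv := h.irr.eq_univ (h1.union h2 (Or.inl hxN) (Or.inl hxK))
    (Or.inr (Or.inr (subset_closure hpR))) (Or.inl (Or.inr (subset_closure hqP)))
  have he' : e ∈ (N ∪ closure Pᶜ) ∪ (K ∪ closure Rᶜ) := huniv ▸ mem_univ e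
  rw [closure_compl, closure_compl] at he'
  rcases he' with (he' | he') | he' | he'
  · exact disjoint_left.1 hNE he' heE
  · exact he' heP
  · exact disjoint_left.1 hKE he' heE
  · exact he' heR

theorem compl_composant_mem_NB (h : IrrCover p q A B) (hD : IsClosed (composant p)ᶜ) :
    (composant p)ᶜ ∈ NB X := by
  refine ⟨⟨q, h.irr.notMem_composant⟩, ne_univ_of_notMem (a := p)
    (not_not.2 (h.left_subset h.mem_left)), hD, fun x hx => h.dense_composant.mono ?_⟩
  intro y hy
  obtain ⟨L, hL, hLne, hpL, hxL⟩ := mem_composant.1 (not_not.1 hx)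
  obtain ⟨K, hK, hKne, hpK, hyK⟩ := mem_composant.1 hy
  have hLK := hL.union hK hpL hpK
  refine ⟨L ∪ K, ⟨hLK.1, hLK.2, Or.inl hxL, ?_⟩, Or.inr hyK⟩
  rw [compl_compl]
  exact union_subset (hL.subset_composant hLne hpL) (hK.subset_composant hKne hpK)

theorem union_mem_NB (h : IrrCover p q A B) (hC : IsClosed (composant q)ᶜ)
    (hD : IsClosed (composant p)ᶜ) : (composant q)ᶜ ∪ (composant p)ᶜ ∈ NB X := by
  have hdisj : Disjoint (composant q)ᶜ (composant p)ᶜ := disjoint_left.2 fun c hc hc' =>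
    hc' (h.mem_composant_of_notMem hc)
  refine ⟨⟨q, Or.inr h.irr.notMem_composant⟩, fun huniv => ?_, hC.union hD, fun x hx => ?_⟩
  · rcases (isPreconnected_iff_subset_of_fully_disjoint_closed isClosed_univ).1
      isPreconnected_univ _ _ hC hD huniv.ge hdisj with h' | h'
    · exact h' (mem_univ q) (h.right_subset h.mem_right)
    · exact h' (mem_univ p) (h.left_subset h.mem_left)
  · simp only [mem_union, mem_compl_iff, not_or, not_not] at hx
    have heq : ⋃₀ {K : Set X | IsCompact K ∧ IsConnected K ∧ x ∈ K ∧
        K ⊆ ((composant q)ᶜ ∪ (composant p)ᶜ)ᶜ} =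
        ⋃₀ {N | IsSubcontinuum N ∧ x ∈ N ∧ N ⊆ composant p ∩ composant q} := by
      rw [compl_union, compl_compl, compl_compl, inter_comm]
      simp only [IsSubcontinuum, and_assoc]
    rw [NotBlocks, heq, dense_iff_closure_eq]
    obtain ⟨c, hc, hcC⟩ := h.closure_sUnion_meets hC hx.2 hx.1
    obtain ⟨d, hd, hdD⟩ := h.symm.closure_sUnion_meets hD hx.1 hx.2
    rw [inter_comm] at hd
    exact h.eq_univ_of_notMem_of_notMem hcC hdD (IsSubcontinuum.closure_sUnion
      ⟨{x}, .singleton x, rfl, singleton_subset_iff.2 ⟨hx.2, hx.1⟩⟩ (fun N hN => hN.1)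
      fun N hN => hN.2.1) hc hd

theorem NB_eq [SecondCountableTopology X] (h : IrrCover p q A B) (hC : IsClosed (composant q)ᶜ)
    (hD : IsClosed (composant p)ᶜ) :
    NB X = {(composant q)ᶜ, (composant p)ᶜ, (composant q)ᶜ ∪ (composant p)ᶜ} := by
  have hCi : interior (closure (composant q)ᶜ) = ∅ := by
    rw [hC.closure_eq, h.symm.interior_compl_composant]
  have hDi : interior (closure (composant p)ᶜ) = ∅ := by
    rw [hD.closure_eq, h.interior_compl_composant]
  ext E
  simp only [mem_insert_iff, mem_singleton_iff]
  constructor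
  · intro hE
    by_cases hCE : (composant q)ᶜ ⊆ E
    · by_cases hDE : (composant p)ᶜ ⊆ E
      · exact Or.inr (Or.inr ((h.subset_union hCi hDi hE).antisymm
          (Set.union_subset hCE hDE)))
      · exact Or.inl ((h.symm.subset_of_not_subset hCi hE hDE).antisymm hCE)
    · exact Or.inr (Or.inl ((h.subset_of_not_subset hDi hE hCE).antisymm
        ((h.subset_or_subset hE).resolve_left hCE)))
  · rintro (rfl | rfl | rfl)
    · exact h.symm.compl_composant_mem_NB hC
    · exact h.compl_composant_mem_NB hD
    · exact h.union_mem_NB hC hD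

/-- If the complement of the composant of `p` is not closed, there is at most one nonblocker. -/
theorem NB_subset_singleton [SecondCountableTopology X] (h : IrrCover p q A B)
    (hD : ¬ IsClosed (composant p)ᶜ) : NB X ⊆ {(composant q)ᶜ} := by
  have not_subset_of : ∀ {p q : X} {A B : Set X}, IrrCover p q A B → ¬ IsClosed (composant p)ᶜ →
      ∀ {E : Set X}, E ∈ NB X → ¬ (composant p)ᶜ ⊆ E := by
    intro p q A B h hD E hE hDE
    refine hD (h.isClosed_compl_composant (subset_empty_iff.1 ?_))
    rw [← interior_eq_empty_of_mem_NB hE]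
    exact interior_mono (closure_minimal hDE hE.2.2.1)
  intro E hE
  have hDE := not_subset_of h hD hE
  have hCE := (h.subset_or_subset hE).resolve_right hDE
  have hC : IsClosed (composant q)ᶜ := not_not.1 fun hC => not_subset_of h.symm hC hE hCE
  refine (h.symm.subset_of_not_subset ?_ hE hDE).antisymm hCE
  rw [hC.closure_eq, h.symm.interior_compl_composant]

theorem isClosed_of_ncard_eq_three [SecondCountableTopology X] (h : IrrCover p q A B)
    (hcard : (NB X).ncard = 3) : IsClosed (composant p)ᶜ := by
  by_contra hD
  have := ncard_le_ncard (h.NB_subset_singleton hD) (finite_singleton _)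
  rw [hcard, ncard_singleton] at this
  omega

end Compact

end IrrCover

theorem stmt9 (X : Type*) [MetricSpace X] [CompactSpace X] [ConnectedSpace X] [Nonempty X]
    (p q : X) (hdec : DecomposableSet (univ : Set X)) (hirr : IrrBetween p q)
    (C D : Set X) (hC : C = (composant q)ᶜ) (hD : D = (composant p)ᶜ) :
    ((C.Nonempty ∧ IsClosed C ∧ D.Nonempty ∧ IsClosed D) ↔ (NB X).ncard = 3) ∧
    ((C.Nonempty ∧ IsClosed C ∧ D.Nonempty ∧ IsClosed D) → NB X = {C, D, C ∪ D}) := by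
  obtain ⟨A, B, h⟩ := hdec.exists_irrCover hirr
  have hpC : p ∈ C := hC ▸ h.irr.symm.notMem_composant
  have hqD : q ∈ D := hD ▸ h.irr.notMem_composant
  have hpD : p ∉ D := hD ▸ not_not.2 (h.left_subset h.mem_left)
  have hqC : q ∉ C := hC ▸ not_not.2 (h.right_subset h.mem_right)
  have hNB : (C.Nonempty ∧ IsClosed C ∧ D.Nonempty ∧ IsClosed D) → NB X = {C, D, C ∪ D} := by
    rintro ⟨-, hCc, -, hDc⟩
    subst hC hD
    exact h.NB_eq hCc hDc
  refine ⟨⟨fun hcl => ?_, fun hcard => ?_⟩, hNB⟩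
  · rw [hNB hcl]
    refine ncard_eq_three.2 ⟨C, D, C ∪ D, ?_, ?_, ?_, rfl⟩
    · exact fun heq => hpD (heq ▸ hpC)
    · exact fun heq => hqC (heq ▸ Or.inr hqD)
    · exact fun heq => hpD (heq ▸ Or.inl hpC)
  · subst hC hD
    exact ⟨⟨p, hpC⟩, h.symm.isClosed_of_ncard_eq_three hcard, ⟨q, hqD⟩,
      h.isClosed_of_ncard_eq_three hcard⟩
end

section
/- Let X be a continuum such that every singleton {x} belongs to NB(F₁(X)), and suppose there exists p ∈ X with {p} ∉ NWC(X). For x ∈ X \ {p}, let s(x) be the union of all subcontinua of X that contain x and are contained in X \ {p}. Then there exist x, y ∈ X \ {p} with s(x) ∩ s(y) = ∅. -/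
open Set Filter Metric

theorem stmt14 (X : Type*) [MetricSpace X] [CompactSpace X] [ConnectedSpace X] [Nonempty X]
    (hNB : ∀ x : X, ({x} : Set X) ∈ NB X)
    (p : X) (hp : ({p} : Set X) ∉ NWC X) :
    ∃ x y : X, x ≠ p ∧ y ≠ p ∧ sComp p x ∩ sComp p y = ∅ := by
  obtain ⟨hne, hproper, hclosed, -⟩ := hNB p
  have hint : interior ({p} : Set X) = ∅ := by
    by_contra h
    have hopen : IsOpen ({p} : Set X) := by
      rw [← interior_eq_iff_isOpen]
      exact (subset_singleton_iff_eq.mp interior_subset).resolve_left h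
    exact hproper (IsClopen.eq_univ ⟨hclosed, hopen⟩ hne)
  by_contra! hcon
  refine hp ⟨hne, hproper, hclosed, hint, fun x hx y hy => ?_⟩
  obtain ⟨z, ⟨K, ⟨hKc, hK, hxK, hKp⟩, hzK⟩, L, ⟨hLc, hL, hyL, hLp⟩, hzL⟩ :=
    hcon x y hx hy
  exact ⟨K ∪ L, hKc.union hLc, hK.union ⟨z, hzK, hzL⟩ hL, union_subset hKp hLp,
    Or.inl hxK, Or.inr hyL⟩
end

section
/- Let X be a continuum such that every singleton {x} belongs to NB(F₁(X)), and suppose there exists p ∈ X with {p} ∉ NWC(X). For x ∈ X \ {p}, let s(x) be the union of all subcontinua of X that contain x and are contained in X \ {p}. Then s(x) has empty interior in X for every x ∈ X \ {p}. -/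
open Set Filter Metric

/-- Two points lying in the same set `sComp p x` are joined by a subcontinuum missing `p`. -/
theorem exists_subcontinuum_of_mem_sComp {X : Type*} [TopologicalSpace X] {p x y z : X}
    (hy : y ∈ sComp p x) (hz : z ∈ sComp p x) :
    ∃ K : Set X, IsCompact K ∧ IsConnected K ∧ K ⊆ ({p} : Set X)ᶜ ∧ y ∈ K ∧ z ∈ K := by
  obtain ⟨K, ⟨hKc, hK, hxK, hKp⟩, hyK⟩ := hy
  obtain ⟨L, ⟨hLc, hL, hxL, hLp⟩, hzL⟩ := hz
  exact ⟨K ∪ L, hKc.union hLc, hK.union ⟨x, hxK, hxL⟩ hL, union_subset hKp hLp,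
    Or.inl hyK, Or.inr hzL⟩

/-- If `sComp p y` and `sComp p x` share a point, then `y ∈ sComp p x`. -/
theorem mem_sComp_of_inter_nonempty {X : Type*} [TopologicalSpace X] {p x y : X}
    (h : (sComp p x ∩ sComp p y).Nonempty) : y ∈ sComp p x := by
  obtain ⟨z, ⟨K, ⟨hKc, hK, hxK, hKp⟩, hzK⟩, L, ⟨hLc, hL, hyL, hLp⟩, hzL⟩ := h
  exact ⟨K ∪ L, ⟨hKc.union hLc, hK.union ⟨z, hzK, hzL⟩ hL, Or.inl hxK, union_subset hKp hLp⟩,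
    Or.inr hyL⟩

theorem stmt15 (X : Type*) [MetricSpace X] [CompactSpace X] [ConnectedSpace X] [Nonempty X]
    (hNB : ∀ x : X, ({x} : Set X) ∈ NB X)
    (p : X) (hp : ({p} : Set X) ∉ NWC X) :
    ∀ x : X, x ≠ p → interior (sComp p x) = ∅ := by
  intro x _
  obtain ⟨hne, hproper, hclosed, hdense⟩ := hNB p
  by_contra hint
  have hmem : ∀ y ∉ ({p} : Set X), y ∈ sComp p x := fun y hy => by
    have hy_dense : Dense (sComp p y) := hdense y hy
    obtain ⟨z, hz, hzy⟩ :=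
      hy_dense.inter_open_nonempty _ isOpen_interior (nonempty_iff_ne_empty.2 hint)
    exact mem_sComp_of_inter_nonempty ⟨z, interior_subset hz, hzy⟩
  obtain ⟨q, hq⟩ := (ne_univ_iff_exists_notMem _).1 hproper
  have : Nontrivial X := ⟨q, p, hq⟩
  exact hp ⟨hne, hproper, hclosed, interior_singleton p, fun y hy z hz =>
    exists_subcontinuum_of_mem_sComp (hmem y hy) (hmem z hz)⟩
end

section
/- Let X be a continuum such that every singleton {x} belongs to NB(F₁(X)), and suppose there exists p ∈ X with {p} ∉ NWC(X). If K is a subcontinuum of X with nonempty interior and A is a nonempty countable compact subset of X \ K, then for every x ∈ K the set A does not block x, i.e., the union of all subcontinua of X that contain x and are contained in X \ A is dense in X. -/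
open Set Filter Metric

theorem nontrivial_of_singleton_ne_univ {X : Type*} {p : X} (h : ({p} : Set X) ≠ univ) :
    Nontrivial X := by
  obtain ⟨x, hx⟩ := (ne_univ_iff_exists_notMem _).1 h
  exact ⟨x, p, hx⟩

/-- If `{p}` is not in `NWC X`, every subcontinuum with nonempty interior contains `p`. -/
theorem interior_eq_empty_of_notMem {X : Type*} [MetricSpace X] [CompactSpace X]
    [ConnectedSpace X] {p : X} (hNB : ({p} : Set X) ∈ NB X) (hp : ({p} : Set X) ∉ NWC X)
    {L : Set X} (hLc : IsCompact L) (hLconn : IsConnected L) (hpL : p ∉ L) :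
    interior L = ∅ := by
  obtain ⟨hne, huniv, hcl, hdense⟩ := hNB
  have := nontrivial_of_singleton_ne_univ huniv
  by_contra hint
  rw [← ne_eq, ← nonempty_iff_ne_empty] at hint
  refine hp ⟨hne, huniv, hcl, interior_singleton p, fun x hx y hy => ?_⟩
  obtain ⟨u, huL, M, ⟨hMc, hMconn, hxM, hMp⟩, huM⟩ :=
    (hdense x hx).inter_open_nonempty _ isOpen_interior hint
  obtain ⟨v, hvL, N, ⟨hNc, hNconn, hyN, hNp⟩, hvN⟩ :=
    (hdense y hy).inter_open_nonempty _ isOpen_interior hint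
  refine ⟨M ∪ L ∪ N, (hMc.union hLc).union hNc,
    (hMconn.union ⟨u, huM, interior_subset huL⟩ hLconn).union
      ⟨v, .inr (interior_subset hvL), hvN⟩ hNconn, ?_, .inl (.inl hxM), .inr hyN⟩
  exact union_subset (union_subset hMp (subset_compl_singleton_iff.2 hpL)) hNp

/-- If subcontinua missing `p` have empty interior, then the union of the subcontinua
that contain `a` and miss `p` is meagre. -/
theorem isMeagre_sComp {X : Type*} [MetricSpace X] [CompactSpace X] {p : X}
    (h : ∀ L : Set X, IsCompact L → IsConnected L → p ∉ L → interior L = ∅) (a : X) :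
    IsMeagre (sComp p a) := by
  let F : ℕ → Set X := fun n => (ball p (1 / ((n : ℝ) + 1)))ᶜ
  have hF (n : ℕ) : IsClosed (F n) := isOpen_ball.isClosed_compl
  have hmeagre (n : ℕ) : IsMeagre (connectedComponentIn (F n) a) := by
    by_cases ha : a ∈ F n
    · have hsub : closure (connectedComponentIn (F n) a) ⊆ F n :=
        closure_minimal (connectedComponentIn_subset _ _) (hF n)
      refine IsNowhereDense.isMeagre (h _ isClosed_closure.isCompact
        (isConnected_connectedComponentIn_iff.2 ha).closure fun hpm => ?_)
      exact hsub hpm (mem_ball_self (by positivity))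
    · rw [connectedComponentIn_eq_empty ha]
      exact IsMeagre.empty
  refine (isMeagre_iUnion hmeagre).mono ?_
  rintro z ⟨L, ⟨hLc, hLconn, haL, hLp⟩, hzL⟩
  obtain ⟨ε, hε, hball⟩ := Metric.isOpen_iff.1 hLc.isClosed.isOpen_compl p
    (subset_compl_singleton_iff.1 hLp)
  obtain ⟨n, hn⟩ := exists_nat_one_div_lt hε
  have hLF : L ⊆ F n :=
    subset_compl_comm.1 ((ball_subset_ball hn.le).trans hball)
  exact mem_iUnion.2 ⟨n, hLconn.isPreconnected.subset_connectedComponentIn haL hLF hzL⟩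

theorem stmt17 (X : Type*) [MetricSpace X] [CompactSpace X] [ConnectedSpace X] [Nonempty X]
    (hNB : ∀ x : X, ({x} : Set X) ∈ NB X)
    (p : X) (hp : ({p} : Set X) ∉ NWC X)
    (K : Set X) (hKc : IsCompact K) (hKconn : IsConnected K) (hKint : (interior K).Nonempty)
    (A : Set X) (hAne : A.Nonempty) (hActble : A.Countable) (hAcomp : IsCompact A)
    (hAK : A ⊆ Kᶜ) :
    ∀ x ∈ K, NotBlocks A x := by
  have hempty : ∀ L : Set X, IsCompact L → IsConnected L → p ∉ L → interior L = ∅ :=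
    fun L hLc hLconn hpL => interior_eq_empty_of_notMem (hNB p) hp hLc hLconn hpL
  have hpm : IsMeagre ({p} : Set X) := by
    have := nontrivial_of_singleton_ne_univ (hNB p).2.1
    exact IsNowhereDense.isMeagre (by rw [IsNowhereDense, closure_singleton, interior_singleton])
  have hmeagre : IsMeagre ({p} ∪ ⋃ a ∈ A, sComp p a) :=
    hpm.union (isMeagre_biUnion hActble fun a _ => isMeagre_sComp hempty a)
  obtain ⟨z, hz⟩ := (dense_of_mem_residual hmeagre).nonempty
  have hzp : z ∉ ({p} : Set X) := fun h => hz (.inl h)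
  have havoid : ∀ L : Set X, IsCompact L → IsConnected L → z ∈ L → L ⊆ ({p} : Set X)ᶜ →
      L ⊆ Aᶜ := fun L hLc hLconn hzL hLp a haL haA =>
    hz (.inr (mem_biUnion haA ⟨L, ⟨hLc, hLconn, haL, hLp⟩, hzL⟩))
  intro x hx
  refine dense_iff_inter_open.2 fun U hU hUne => ?_
  obtain ⟨u, huK, M, ⟨hMc, hMconn, hzM, hMp⟩, huM⟩ :=
    ((hNB p).2.2.2 z hzp).inter_open_nonempty _ isOpen_interior hKint
  obtain ⟨v, hvU, N, ⟨hNc, hNconn, hzN, hNp⟩, hvN⟩ :=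
    ((hNB p).2.2.2 z hzp).inter_open_nonempty U hU hUne
  refine ⟨v, hvU, K ∪ M ∪ N, ⟨(hKc.union hMc).union hNc,
    (hKconn.union ⟨u, interior_subset huK, huM⟩ hMconn).union ⟨z, .inr hzM, hzN⟩ hNconn,
    .inl (.inl hx), ?_⟩, .inr hvN⟩
  exact union_subset (union_subset (subset_compl_comm.1 hAK) (havoid M hMc hMconn hzM hMp))
    (havoid N hNc hNconn hzN hNp)
end

section
/- Let X be a continuum such that NB(F₁(X)) = F₁(X). Then X \ K is connected for every proper subcontinuum K of X. -/
open Set Filter Metric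

/-- If a closed connected set `K` has complement the disjoint union of the open sets `U` and `V`,
then adding to `K` the part in `U` of a closed connected set meeting `K` keeps it connected. -/
theorem isConnected_union_inter_of_compl_eq {X : Type*} [TopologicalSpace X] {K L U V : Set X}
    (hKc : IsClosed K) (hK : IsConnected K) (hLc : IsClosed L) (hL : IsPreconnected L)
    (hU : IsOpen U) (hV : IsOpen V) (hUV : Disjoint U V) (hKUV : Kᶜ = U ∪ V)
    (hKL : (K ∩ L).Nonempty) :
    IsClosed (K ∪ L ∩ U) ∧ IsConnected (K ∪ L ∩ U) := by
  have hmem : ∀ z, z ∉ K ↔ z ∈ U ∨ z ∈ V := fun z => by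
    rw [← mem_compl_iff, hKUV, mem_union]
  have hdisj : ∀ z, z ∈ U → z ∉ V := fun z hz => disjoint_left.mp hUV hz
  have hM : IsClosed (K ∪ L ∩ U) := by
    have : K ∪ L ∩ U = (K ∪ L) ∩ Vᶜ := by
      ext z
      have h1 := hmem z
      have h2 := hdisj z
      simp only [mem_union, mem_inter_iff, mem_compl_iff]
      tauto
    rw [this]
    exact (hKc.union hLc).inter hV.isClosed_compl
  obtain ⟨k, hkK, hkL⟩ := hKL
  refine ⟨hM, ⟨k, Or.inl hkK⟩, ?_⟩
  have hKL' : IsPreconnected (K ∪ L) := hK.isPreconnected.union k hkK hkL hL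
  have key : ∀ P Q : Set X, IsClosed P → IsClosed Q → K ∪ L ∩ U ⊆ P ∪ Q →
      (K ∪ L ∩ U) ∩ (P ∩ Q) = ∅ → K ⊆ P → K ∪ L ∩ U ⊆ P := by
    intro P Q hP hQ hcov hPQ hKP
    have hPQ' : ∀ z, z ∈ K ∪ L ∩ U → z ∈ P → z ∉ Q := fun z h1 h2 h3 =>
      (eq_empty_iff_forall_notMem.mp hPQ) z ⟨h1, h2, h3⟩
    have hsplit := isPreconnected_iff_subset_of_disjoint_closed.mp hKL'
      (P ∩ (K ∪ L ∩ U) ∪ L ∩ Uᶜ) (Q ∩ (K ∪ L ∩ U))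
      ((hP.inter hM).union (hLc.inter hU.isClosed_compl)) (hQ.inter hM)
      (by
        intro z hz
        by_cases hzM : z ∈ K ∪ L ∩ U
        · rcases hcov hzM with h | h
          · exact Or.inl (Or.inl ⟨h, hzM⟩)
          · exact Or.inr ⟨h, hzM⟩
        · have hzK : z ∉ K := fun h => hzM (Or.inl h)
          have hzL : z ∈ L := hz.resolve_left hzK
          exact Or.inl (Or.inr ⟨hzL, fun h => hzM (Or.inr ⟨hzL, h⟩)⟩))
      (by
        rw [eq_empty_iff_forall_notMem]
        rintro z ⟨-, (⟨hzP, hzM⟩ | ⟨-, hzU⟩), hzQ, hzM'⟩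
        · exact hPQ' z hzM hzP hzQ
        · have hzK : z ∈ K := hzM'.resolve_right fun h => hzU h.2
          exact hPQ' z hzM' (hKP hzK) hzQ)
    rcases hsplit with h | h
    · rintro z (hz | hz)
      · exact hKP hz
      · rcases h (Or.inr hz.1) with h' | h'
        · exact h'.1
        · exact absurd hz.2 h'.2
    · exact absurd (h (Or.inl hkK)).1 (hPQ' k (Or.inl hkK) (hKP hkK))
  rw [isPreconnected_iff_subset_of_disjoint_closed]
  intro P Q hP hQ hcov hPQ
  rcases isPreconnected_iff_subset_of_disjoint_closed.mp hK.isPreconnected P Q hP hQ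
    (subset_union_left.trans hcov)
    (subset_empty_iff.mp (hPQ ▸ inter_subset_inter_left _ subset_union_left)) with h | h
  · exact Or.inl (key P Q hP hQ hcov hPQ h)
  · exact Or.inr (key Q P hQ hP (union_comm P Q ▸ hcov) (inter_comm P Q ▸ hPQ) h)

/-- If `{u}` does not block `x`, where `u, x ∈ U`, then `x` can be joined to `K` by a
subcontinuum of `K ∪ U` missing `u`. -/
theorem exists_isConnected_of_notBlocks_singleton {X : Type*} [TopologicalSpace X] [T2Space X]
    {K U V : Set X} {u x : X} (hKc : IsCompact K) (hK : IsConnected K)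
    (hU : IsOpen U) (hV : IsOpen V) (hUV : Disjoint U V) (hKUV : Kᶜ = U ∪ V)
    (hVne : V.Nonempty) (hu : u ∈ U) (hx : x ∈ U) (hb : NotBlocks {u} x) :
    ∃ M, IsClosed M ∧ IsConnected M ∧ K ⊆ M ∧ x ∈ M ∧ u ∉ M ∧ Disjoint M V := by
  obtain ⟨w, hwV, L, ⟨hLc, hL, hxL, hLu⟩, hwL⟩ := hb.inter_open_nonempty V hV hVne
  have hKL : (K ∩ L).Nonempty := by
    by_contra hne
    have hLK : L ⊆ U ∪ V := by
      rw [← hKUV]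
      exact fun z hz hzK => hne ⟨z, hzK, hz⟩
    obtain ⟨z, -, hzU, hzV⟩ := hL.isPreconnected U V hU hV hLK ⟨x, hxL, hx⟩ ⟨w, hwL, hwV⟩
    exact disjoint_left.mp hUV hzU hzV
  obtain ⟨h1, h2⟩ := isConnected_union_inter_of_compl_eq hKc.isClosed hK hLc.isClosed
    hL.isPreconnected hU hV hUV hKUV hKL
  have hKmem : ∀ z ∈ U ∪ V, z ∉ K := fun z hz => by rwa [← hKUV] at hz
  refine ⟨K ∪ L ∩ U, h1, h2, subset_union_left, Or.inr ⟨hxL, hx⟩, ?_, ?_⟩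
  · rintro (h | h)
    · exact hKmem u (Or.inl hu) h
    · exact hLu h.1 rfl
  · rw [disjoint_left]
    rintro z (h | h) hzV
    · exact hKmem z (Or.inr hzV) h
    · exact disjoint_left.mp hUV h.2 hzV

theorem stmt18 (X : Type*) [MetricSpace X] [CompactSpace X] [ConnectedSpace X] [Nonempty X]
    (h : NB X = F1 X) :
    ∀ K : Set X, IsCompact K → IsConnected K → K ≠ univ → IsConnected Kᶜ := by
  intro K hKc hK hKuniv
  refine ⟨nonempty_compl.mpr hKuniv, ?_⟩
  intro A B hA hB hcov hAne hBne
  by_contra hAB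
  obtain ⟨u, huK, huA⟩ := hAne
  obtain ⟨v, hvK, hvB⟩ := hBne
  have hU : IsOpen (Kᶜ ∩ A) := hKc.isClosed.isOpen_compl.inter hA
  have hV : IsOpen (Kᶜ ∩ B) := hKc.isClosed.isOpen_compl.inter hB
  have hUV : Disjoint (Kᶜ ∩ A) (Kᶜ ∩ B) :=
    disjoint_left.mpr fun z hz hz' => hAB ⟨z, hz.1, hz.2, hz'.2⟩
  have hKUV : Kᶜ = Kᶜ ∩ A ∪ Kᶜ ∩ B := by
    rw [← inter_union_distrib_left, inter_eq_left.mpr hcov]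
  have hu : u ∈ Kᶜ ∩ A := ⟨huK, huA⟩
  have hv : v ∈ Kᶜ ∩ B := ⟨hvK, hvB⟩
  generalize Kᶜ ∩ A = U at hU hUV hKUV hu
  generalize Kᶜ ∩ B = V at hV hUV hKUV hv
  have huv : u ≠ v := fun e => disjoint_left.mp hUV hu (e ▸ hv)
  have hb : ∀ p x : X, x ≠ p → NotBlocks {p} x := fun p x hxp =>
    (show {p} ∈ NB X from h ▸ ⟨p, rfl⟩).2.2.2 x hxp
  have hjoin : ∀ x ∉ ({u, v} : Set X),
      ∃ M, IsClosed M ∧ IsConnected M ∧ K ⊆ M ∧ x ∈ M ∧ M ⊆ ({u, v} : Set X)ᶜ := by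
    intro x hx
    simp only [mem_insert_iff, mem_singleton_iff, not_or] at hx
    by_cases hxK : x ∈ K
    · refine ⟨K, hKc.isClosed, hK, Subset.rfl, hxK, ?_⟩
      rintro z hz (rfl | rfl)
      · exact huK hz
      · exact hvK hz
    · rcases (hKUV ▸ hxK : x ∈ U ∪ V) with hxU | hxV
      · obtain ⟨M, h1, h2, h3, h4, h5, h6⟩ := exists_isConnected_of_notBlocks_singleton
          hKc hK hU hV hUV hKUV ⟨v, hv⟩ hu hxU (hb u x hx.1)
        refine ⟨M, h1, h2, h3, h4, ?_⟩
        rintro z hz (rfl | rfl)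
        · exact h5 hz
        · exact disjoint_left.mp h6 hz hv
      · obtain ⟨M, h1, h2, h3, h4, h5, h6⟩ := exists_isConnected_of_notBlocks_singleton
          hKc hK hV hU hUV.symm (hKUV.trans (union_comm U V)) ⟨u, hu⟩ hv hxV (hb v x hx.2)
        refine ⟨M, h1, h2, h3, h4, ?_⟩
        rintro z hz (rfl | rfl)
        · exact disjoint_left.mp h6 hz hu
        · exact h5 hz
  obtain ⟨k, hk⟩ := hK.nonempty
  have : Nontrivial X := ⟨u, v, huv⟩
  have hNB : ({u, v} : Set X) ∈ NB X := by
    refine ⟨⟨u, Or.inl rfl⟩, ?_, (toFinite _).isClosed, ?_⟩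
    · intro e
      rcases (e ▸ mem_univ k : k ∈ ({u, v} : Set X)) with rfl | rfl
      · exact huK hk
      · exact hvK hk
    · intro x hx
      obtain ⟨M, hM, hMc, hKM, hxM, hMuv⟩ := hjoin x hx
      refine (dense_univ.sdiff_finite (toFinite ({u, v} : Set X))).mono ?_
      rintro y ⟨-, hy⟩
      obtain ⟨N, hN, hNc, hKN, hyN, hNuv⟩ := hjoin y hy
      exact ⟨M ∪ N, ⟨(hM.union hN).isCompact, hMc.union ⟨k, hKM hk, hKN hk⟩ hNc, Or.inl hxM,
        union_subset hMuv hNuv⟩, Or.inr hyN⟩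
  rw [h] at hNB
  obtain ⟨p, hp⟩ := hNB
  exact huv ((hp ▸ Or.inl rfl : u ∈ ({p} : Set X)).trans
    (hp ▸ Or.inr rfl : v ∈ ({p} : Set X)).symm)
end
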